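/- arXiv:2204.01461 — 4 statements merged into one kernel-verified Lean document; each statement's English description precedes it below -/
import Mathlib

section
/- Every weakly proper Hadamard space (H, d) is Hausdorff with respect to the weak topology τ_w: for any two distinct points x, y ∈ H there exist disjoint weakly open sets U and V with x ∈ U and y ∈ V. -/
open Filter Topology

/-- A geodesic structure on a metric space: a geodesic map `G` satisfying the
constant-speed property and the CAT(0) comparison inequality. Together with
completeness of the metric this makes the space a Hadamard space. -/
structure GeodesicStructure (H : Type*) [MetricSpace H] where
  G : H → H → ℝ → H
  G_zero : ∀ x y, G x y 0 = x
  G_one : ∀ x y, G x y 1 = y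
  G_dist : ∀ x y, ∀ s ∈ Set.Icc (0:ℝ) 1, ∀ t ∈ Set.Icc (0:ℝ) 1,
    dist (G x y s) (G x y t) = |s - t| * dist x y
  cat0 : ∀ x y z : H, ∀ t ∈ Set.Icc (0:ℝ) 1,
    dist (G x y t) z ^ 2 ≤
      (1 - t) * dist x z ^ 2 + t * dist y z ^ 2 - t * (1 - t) * dist x y ^ 2

variable {H : Type*} [MetricSpace H]

/-- The geodesic segment `[x,y]`. -/
def seg (D : GeodesicStructure H) (x y : H) : Set H :=
  (fun t => D.G x y t) '' Set.Icc (0:ℝ) 1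

/-- `P` is the metric-projection map: `P x y z` is the (unique) nearest point
to `z` on the geodesic segment `[x,y]`. -/
def IsProjMap (D : GeodesicStructure H) (P : H → H → H → H) : Prop :=
  ∀ x y z : H, P x y z ∈ seg D x y ∧ ∀ q ∈ seg D x y, dist z (P x y z) ≤ dist z q

/-- The set `U_x(ε; y_1, …, y_k)` for the finite family `Y` of endpoints. -/
def elemSet (P : H → H → H → H) (x : H) (ε : ℝ) (Y : Finset H) : Set H :=
  {z : H | ∀ y ∈ Y, dist x (P x y z) < ε}

/-- A set is weakly open if each of its points admits a basic set
`U_x(ε; y_1, …, y_k)` inside it. -/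
def WeaklyOpen (P : H → H → H → H) (U : Set H) : Prop :=
  ∀ x ∈ U, ∃ ε > (0:ℝ), ∃ Y : Finset H, Y.Nonempty ∧ elemSet P x ε Y ⊆ U

/-- Weak convergence: `d(l, P_{[l,y]} x_n) → 0` for every `y`. -/
def WeakConv (P : H → H → H → H) (x : ℕ → H) (l : H) : Prop :=
  ∀ y : H, Tendsto (fun n => dist l (P l y (x n))) atTop (nhds 0)

/-- The space is weakly proper if every point is interior (w.r.t. the weak
topology) to each of its elementary sets. -/
def WeaklyProper (P : H → H → H → H) : Prop :=
  ∀ (x : H) (ε : ℝ), 0 < ε → ∀ y : H,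
    ∃ V : Set H, WeaklyOpen P V ∧ x ∈ V ∧ V ⊆ elemSet P x ε {y}

/-- Geodesic convexity of a set. -/
def GConvex (D : GeodesicStructure H) (C : Set H) : Prop :=
  ∀ a ∈ C, ∀ b ∈ C, ∀ t ∈ Set.Icc (0:ℝ) 1, D.G a b t ∈ C

/-- Reversing the endpoints reverses the geodesic. -/
theorem GeodesicStructure.G_symm (D : GeodesicStructure H) (x y : H) {t : ℝ}
    (ht : t ∈ Set.Icc (0:ℝ) 1) : D.G y x t = D.G x y (1 - t) := by
  have ht' : 1 - t ∈ Set.Icc (0:ℝ) 1 := ⟨by linarith [ht.2], by linarith [ht.1]⟩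
  have hy : dist y (D.G y x t) = t * dist x y := by
    have h := D.G_dist y x 0 ⟨le_rfl, zero_le_one⟩ t ht
    rwa [D.G_zero, zero_sub, abs_neg, abs_of_nonneg ht.1, dist_comm y x] at h
  have hx : dist x (D.G y x t) = (1 - t) * dist x y := by
    have h := D.G_dist y x 1 ⟨zero_le_one, le_rfl⟩ t ht
    rwa [D.G_one, abs_of_nonneg ht'.1, dist_comm y x] at h
  have h := D.cat0 x y (D.G y x t) (1 - t) ht'
  rw [hx, hy] at h
  have h0 : dist (D.G x y (1 - t)) (D.G y x t) ^ 2 ≤ 0 := by linarith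
  exact (dist_eq_zero.1 (pow_eq_zero_iff two_ne_zero |>.1 (le_antisymm h0 (sq_nonneg _)))).symm

theorem seg_comm (D : GeodesicStructure H) (x y : H) : seg D x y = seg D y x := by
  have key : ∀ x y : H, seg D y x ⊆ seg D x y := by
    rintro x y _ ⟨t, ht, rfl⟩
    exact ⟨1 - t, ⟨by linarith [ht.2], by linarith [ht.1]⟩, (D.G_symm x y ht).symm⟩
  exact (key y x).antisymm (key x y)

/-- A metric midpoint of two points is the midpoint of the geodesic joining them. -/
theorem GeodesicStructure.G_half_eq (D : GeodesicStructure H) {p q m : H}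
    (hp : dist p m = dist p q / 2) (hq : dist q m = dist p q / 2) : D.G p q (1 / 2) = m := by
  have h := D.cat0 p q m (1 / 2) ⟨by norm_num, by norm_num⟩
  rw [hp, hq] at h
  have h0 : dist (D.G p q (1 / 2)) m ^ 2 ≤ 0 := by linarith
  exact dist_eq_zero.1 (pow_eq_zero_iff two_ne_zero |>.1 (le_antisymm h0 (sq_nonneg _)))

/-- Geodesic segments contain the midpoint of any two of their points. -/
theorem GeodesicStructure.G_half_mem_seg (D : GeodesicStructure H) {x y p q : H}
    (hp : p ∈ seg D x y) (hq : q ∈ seg D x y) : D.G p q (1 / 2) ∈ seg D x y := by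
  obtain ⟨s, hs, rfl⟩ := hp
  obtain ⟨t, ht, rfl⟩ := hq
  have hm : (s + t) / 2 ∈ Set.Icc (0:ℝ) 1 :=
    ⟨by linarith [hs.1, ht.1], by linarith [hs.2, ht.2]⟩
  refine ⟨(s + t) / 2, hm, (D.G_half_eq ?_ ?_).symm⟩
  · rw [D.G_dist x y s hs _ hm, D.G_dist x y s hs t ht,
      show s - (s + t) / 2 = (s - t) / 2 by ring, abs_div, abs_two]
    ring
  · rw [D.G_dist x y t ht _ hm, D.G_dist x y s hs t ht,
      show t - (s + t) / 2 = -((s - t) / 2) by ring, abs_neg, abs_div, abs_two]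
    ring

/-- The nearest point on a geodesic segment is unique. -/
theorem GeodesicStructure.nearest_unique (D : GeodesicStructure H) {x y z p q : H}
    (hp : p ∈ seg D x y) (hq : q ∈ seg D x y)
    (hpmin : ∀ r ∈ seg D x y, dist z p ≤ dist z r)
    (hqmin : ∀ r ∈ seg D x y, dist z q ≤ dist z r) : p = q := by
  have hpq : dist z p = dist z q := le_antisymm (hpmin q hq) (hqmin p hp)
  have hm := hpmin _ (D.G_half_mem_seg hp hq)
  have h := D.cat0 p q z (1 / 2) ⟨by norm_num, by norm_num⟩
  rw [dist_comm _ z, dist_comm p z, dist_comm q z, ← hpq] at h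
  have hsq := pow_le_pow_left₀ dist_nonneg hm 2
  have h0 : dist p q ^ 2 ≤ 0 := by linarith
  exact dist_eq_zero.1 (pow_eq_zero_iff two_ne_zero |>.1 (le_antisymm h0 (sq_nonneg _)))

theorem IsProjMap.comm {D : GeodesicStructure H} {P : H → H → H → H} (hP : IsProjMap D P)
    (x y z : H) : P x y z = P y x z := by
  have h := hP y x z
  rw [← seg_comm D x y] at h
  exact D.nearest_unique (hP x y z).1 h.1 (hP x y z).2 h.2

/-- every weakly proper Hadamard space is Hausdorff in the weak
topology. -/
theorem stmt3 [CompleteSpace H] (D : GeodesicStructure H) (P : H → H → H → H)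
    (hP : IsProjMap D P) (hproper : WeaklyProper P) :
    ∀ x y : H, x ≠ y → ∃ U V : Set H, WeaklyOpen P U ∧ WeaklyOpen P V ∧
      x ∈ U ∧ y ∈ V ∧ Disjoint U V := by
  intro x y hxy
  have hε : 0 < dist x y / 2 := half_pos (dist_pos.2 hxy)
  obtain ⟨U, hU, hxU, hUsub⟩ := hproper x _ hε y
  obtain ⟨V, hV, hyV, hVsub⟩ := hproper y _ hε x
  refine ⟨U, V, hU, hV, hxU, hyV, Set.disjoint_left.2 fun z hzU hzV => ?_⟩
  have h₁ := hUsub hzU y (Finset.mem_singleton_self y)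
  have h₂ := hVsub hzV x (Finset.mem_singleton_self x)
  rw [← hP.comm x y z] at h₂
  linarith [dist_triangle_right x y (P x y z)]
end

section
/- (Mazur's Lemma in Hadamard spaces.) Let (H, d) be a Hadamard space and (x_n) a sequence in H with x_n ⇀ x for some x ∈ H. Then there exist a function N : ℕ → ℕ and a sequence (y_n) in H such that y_n ∈ co({x_1, …, x_{N(n)}}) for every n ∈ ℕ and d(y_n, x) → 0. -/
open Filter Topology

variable {H : Type*} [MetricSpace H]

/-- The convex hull of the first `N + 1` terms of a sequence. -/
def initialHull (D : GeodesicStructure H) (x : ℕ → H) (N : ℕ) : Set H :=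
  ⋂₀ {C : Set H | GConvex D C ∧ x '' Set.Iic N ⊆ C}

theorem initialHull_mono (D : GeodesicStructure H) (x : ℕ → H) : Monotone (initialHull D x) := by
  intro M N hMN z hz C hC
  exact hz C ⟨hC.1, (Set.image_mono (Set.Iic_subset_Iic.2 hMN)).trans hC.2⟩

theorem gConvex_iUnion_initialHull (D : GeodesicStructure H) (x : ℕ → H) :
    GConvex D (⋃ N, initialHull D x N) := by
  intro a ha b hb t ht
  obtain ⟨M, hM⟩ := Set.mem_iUnion.1 ha
  obtain ⟨N, hN⟩ := Set.mem_iUnion.1 hb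
  refine Set.mem_iUnion.2 ⟨max M N, fun C hC => hC.1 a ?_ b ?_ t ht⟩
  · exact initialHull_mono D x (le_max_left M N) hM C hC
  · exact initialHull_mono D x (le_max_right M N) hN C hC

theorem mem_iUnion_initialHull (D : GeodesicStructure H) (x : ℕ → H) (n : ℕ) :
    x n ∈ ⋃ N, initialHull D x N :=
  Set.mem_iUnion.2 ⟨n, fun _ hC => hC.2 ⟨n, Set.self_mem_Iic, rfl⟩⟩

/-- A point of the closure of a convex set that is nearest to `q` satisfies the
Pythagorean inequality. -/
theorem GConvex.dist_sq_add_dist_sq_le {D : GeodesicStructure H} {K : Set H} (hK : GConvex D K)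
    {p q c : H} (hp : p ∈ closure K) (hmin : ∀ k ∈ K, dist p q ≤ dist k q) (hc : c ∈ K) :
    dist p q ^ 2 + dist p c ^ 2 ≤ dist c q ^ 2 := by
  obtain ⟨k, hkK, hk⟩ := mem_closure_iff_seq_limit.1 hp
  have key : ∀ u ∈ Set.Ioo (0:ℝ) 1, dist p q ^ 2 + (1 - u) * dist p c ^ 2 ≤ dist c q ^ 2 := by
    intro u hu
    have hu' : u ∈ Set.Icc (0:ℝ) 1 := Set.Ioo_subset_Icc_self hu
    have hlim : Tendsto (fun n => (1 - u) * dist (k n) q ^ 2 + u * dist c q ^ 2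
        - u * (1 - u) * dist (k n) c ^ 2) atTop
        (𝓝 ((1 - u) * dist p q ^ 2 + u * dist c q ^ 2 - u * (1 - u) * dist p c ^ 2)) :=
      ((((hk.dist tendsto_const_nhds).pow 2).const_mul _).add_const _).sub
        (((hk.dist tendsto_const_nhds).pow 2).const_mul _)
    have hle := ge_of_tendsto' hlim (b := dist p q ^ 2) fun n =>
      (pow_le_pow_left₀ dist_nonneg (hmin _ (hK _ (hkK n) c hc u hu')) 2).trans
        (D.cat0 (k n) c q u hu')
    refine le_of_mul_le_mul_left ?_ hu.1
    linarith
  have hlim : Tendsto (fun u : ℝ => dist p q ^ 2 + (1 - u) * dist p c ^ 2) (𝓝[>] 0)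
      (𝓝 (dist p q ^ 2 + dist p c ^ 2)) := by
    have hcont : Continuous fun u : ℝ => dist p q ^ 2 + (1 - u) * dist p c ^ 2 := by fun_prop
    simpa using (hcont.tendsto 0).mono_left nhdsWithin_le_nhds
  refine le_of_tendsto hlim ?_
  filter_upwards [Ioo_mem_nhdsGT (zero_lt_one' ℝ)] with u hu using key u hu

/-- In a Hadamard space the closure of a nonempty convex set contains a point nearest to `l`. -/
theorem GConvex.exists_nearest_mem_closure [CompleteSpace H] {D : GeodesicStructure H} {K : Set H}
    (hK : GConvex D K) (hne : K.Nonempty) (l : H) :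
    ∃ p ∈ closure K, ∀ k ∈ K, dist p l ≤ dist k l := by
  set r := Metric.infDist l K
  have hr : 0 ≤ r := Metric.infDist_nonneg
  have hrle : ∀ k ∈ K, r ≤ dist k l := fun k hk => by
    simpa only [dist_comm k l] using Metric.infDist_le_dist_of_mem hk
  have hex : ∀ n : ℕ, ∃ k ∈ K, dist k l ^ 2 < r ^ 2 + 1 / ((n : ℝ) + 1) := by
    intro n
    have hpos : 0 < 1 / ((n : ℝ) + 1) := by positivity
    have hlt : r < √(r ^ 2 + 1 / ((n : ℝ) + 1)) := Real.lt_sqrt_of_sq_lt (by linarith)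
    obtain ⟨k, hk, hkl⟩ := (Metric.infDist_lt_iff hne).1 hlt
    exact ⟨k, hk, by rw [dist_comm]; exact (Real.lt_sqrt dist_nonneg).1 hkl⟩
  choose k hkK hk using hex
  have hinv : Tendsto (fun n : ℕ => 1 / ((n : ℝ) + 1)) atTop (𝓝 0) :=
    tendsto_one_div_add_atTop_nhds_zero_nat
  have hcauchy : CauchySeq k := by
    have hb : Tendsto (fun n : ℕ => √(4 * (1 / ((n : ℝ) + 1)))) atTop (𝓝 0) := by
      simpa using (hinv.const_mul 4).sqrt
    refine cauchySeq_of_le_tendsto_0 _ (fun n m N hn hm => Real.le_sqrt_of_sq_le ?_) hb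
    have hhalf : (1 / 2 : ℝ) ∈ Set.Icc (0:ℝ) 1 := by norm_num
    have hcat := D.cat0 (k n) (k m) l (1 / 2) hhalf
    have hmid := pow_le_pow_left₀ hr (hrle _ (hK _ (hkK n) _ (hkK m) (1 / 2) hhalf)) 2
    have hn' := Nat.one_div_le_one_div (α := ℝ) hn
    have hm' := Nat.one_div_le_one_div (α := ℝ) hm
    linarith [hk n, hk m]
  obtain ⟨p, hp⟩ := cauchySeq_tendsto_of_complete hcauchy
  refine ⟨p, mem_closure_of_tendsto hp (Eventually.of_forall hkK), fun c hc => ?_⟩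
  have hsq : dist p l ^ 2 ≤ r ^ 2 := by
    have hlim : Tendsto (fun n : ℕ => r ^ 2 + 1 / ((n : ℝ) + 1)) atTop (𝓝 (r ^ 2)) := by
      simpa using hinv.const_add (r ^ 2)
    exact le_of_tendsto_of_tendsto' ((hp.dist tendsto_const_nhds).pow 2) hlim fun n => (hk n).le
  exact (le_of_sq_le_sq hsq hr).trans (hrle c hc)

/-- If `p` is nearest to `l` in the closure of a convex set `K`, then every point of `K`
projects to `p` on the segment `[l, p]`. -/
theorem IsProjMap.eq_of_nearest {D : GeodesicStructure H} {P : H → H → H → H}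
    (hP : IsProjMap D P) {K : Set H} (hK : GConvex D K) {l p c : H} (hp : p ∈ closure K)
    (hmin : ∀ k ∈ K, dist p l ≤ dist k l) (hc : c ∈ K) : P l p c = p := by
  obtain ⟨⟨t, ht, hq⟩, hnear⟩ := hP l p c
  have hpseg : p ∈ seg D l p := ⟨1, by norm_num, D.G_one l p⟩
  have hle := hnear p hpseg
  generalize P l p c = q at hq hle
  have hsum : dist l p = dist l q + dist q p := by
    have h₀ := D.G_dist l p 0 (by norm_num) t ht
    have h₁ := D.G_dist l p t ht 1 (by norm_num)
    rw [D.G_zero, zero_sub, abs_neg, abs_of_nonneg ht.1] at h₀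
    rw [D.G_one, abs_of_nonpos (by linarith [ht.2])] at h₁
    rw [← hq, h₀, h₁]
    ring
  have hminq : ∀ k ∈ K, dist p q ≤ dist k q := fun k hk => by
    linarith [hmin k hk, dist_triangle k q l, dist_comm l p, dist_comm l q, dist_comm p q]
  have hpyth := hK.dist_sq_add_dist_sq_le hp hminq hc
  rw [dist_comm p c] at hpyth
  have hzero : dist p q ^ 2 ≤ 0 := by
    linarith [pow_le_pow_left₀ dist_nonneg hle 2]
  exact (dist_eq_zero.1 (pow_eq_zero_iff two_ne_zero |>.1 (le_antisymm hzero (sq_nonneg _)))).symm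

/-- Mazur's lemma in Hadamard spaces: if `x_n ⇀ l` then some
sequence `y_n` with `y_n` in the convex hull of `{x_0, …, x_{N n}}` converges
strongly to `l`. -/
theorem stmt5 [CompleteSpace H] (D : GeodesicStructure H) (P : H → H → H → H)
    (hP : IsProjMap D P) (x : ℕ → H) (l : H) (hw : WeakConv P x l) :
    ∃ (N : ℕ → ℕ) (y : ℕ → H),
      (∀ n : ℕ, y n ∈ ⋂₀ {C : Set H | GConvex D C ∧ x '' Set.Iic (N n) ⊆ C}) ∧
      Tendsto y atTop (nhds l) := by
  have hK := gConvex_iUnion_initialHull D x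
  obtain ⟨p, hp, hmin⟩ :=
    hK.exists_nearest_mem_closure ⟨_, mem_iUnion_initialHull D x 0⟩ l
  have hproj : ∀ n, P l p (x n) = p := fun n =>
    hP.eq_of_nearest hK hp hmin (mem_iUnion_initialHull D x n)
  have hlp : l = p := by
    have hlim := hw p
    simp only [hproj] at hlim
    exact dist_eq_zero.1 (tendsto_nhds_unique tendsto_const_nhds hlim)
  rw [← hlp] at hp
  obtain ⟨y, hyK, hy⟩ := mem_closure_iff_seq_limit.1 hp
  choose N hN using fun n => Set.mem_iUnion.1 (hyK n)
  exact ⟨N, y, hN, hy⟩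
end

section
/- Let (H, d) be a Hadamard space whose weak topology τ_w is Hausdorff, and let K ⊆ H be a bounded set. If K is compact in τ_w, then K is weakly sequentially compact: every sequence in K has a subsequence converging weakly to a point of K. -/
open Filter Topology

variable {H : Type*} [MetricSpace H]

/-- The radii of balls that contain `x n` for eventually all `n` along the filter `F`. -/
def eventualRadii (x : ℕ → H) (F : Filter ℕ) : Set ℝ :=
  {r | ∃ y, ∀ᶠ n in F, dist (x n) y ≤ r}

/-- The asymptotic radius of the sequence `x` along the filter `F`. -/
noncomputable def asympRadius (x : ℕ → H) (F : Filter ℕ) : ℝ :=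
  sInf (eventualRadii x F)

lemma nonneg_of_mem_eventualRadii {x : ℕ → H} {F : Filter ℕ} [F.NeBot] {r : ℝ}
    (hr : r ∈ eventualRadii x F) : 0 ≤ r := by
  obtain ⟨y, hy⟩ := hr
  obtain ⟨n, hn⟩ := hy.exists
  exact dist_nonneg.trans hn

lemma asympRadius_nonneg (x : ℕ → H) (F : Filter ℕ) [F.NeBot] : 0 ≤ asympRadius x F :=
  Real.sInf_nonneg fun _ hr => nonneg_of_mem_eventualRadii hr

lemma asympRadius_le {x : ℕ → H} {F : Filter ℕ} [F.NeBot] {r : ℝ}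
    (hr : r ∈ eventualRadii x F) : asympRadius x F ≤ r :=
  csInf_le ⟨0, fun _ h => nonneg_of_mem_eventualRadii h⟩ hr

lemma eventualRadii_nonempty {x : ℕ → H} (hx : Bornology.IsBounded (Set.range x))
    (F : Filter ℕ) : (eventualRadii x F).Nonempty := by
  obtain ⟨r, hr⟩ := hx.subset_closedBall (x 0)
  exact ⟨r, x 0, Eventually.of_forall fun n => hr (Set.mem_range_self n)⟩

lemma asympRadius_mono {x : ℕ → H} (hx : Bornology.IsBounded (Set.range x))
    {F G : Filter ℕ} [G.NeBot] (h : G ≤ F) : asympRadius x G ≤ asympRadius x F :=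
  csInf_le_csInf ⟨0, fun _ h => nonneg_of_mem_eventualRadii h⟩ (eventualRadii_nonempty hx F)
    fun _ ⟨y, hy⟩ => ⟨y, hy.filter_mono h⟩

/-- Two points that are almost asymptotic centers are close to each other. -/
lemma dist_sq_le_of_eventually_le (D : GeodesicStructure H) {x : ℕ → H} {F : Filter ℕ}
    [F.NeBot] {y z : H} {a : ℝ} (hy : ∀ᶠ n in F, dist (x n) y ≤ a)
    (hz : ∀ᶠ n in F, dist (x n) z ≤ a) :
    dist y z ^ 2 ≤ 4 * (a ^ 2 - asympRadius x F ^ 2) := by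
  have hm : ∀ᶠ n in F, dist (x n) (D.G y z (1 / 2)) ^ 2 ≤ a ^ 2 - dist y z ^ 2 / 4 := by
    filter_upwards [hy, hz] with n h₁ h₂
    have h := D.cat0 y z (x n) (1 / 2) ⟨by norm_num, by norm_num⟩
    rw [dist_comm _ (x n), dist_comm y (x n), dist_comm z (x n)] at h
    have h₁' := pow_le_pow_left₀ dist_nonneg h₁ 2
    have h₂' := pow_le_pow_left₀ dist_nonneg h₂ 2
    linarith
  obtain ⟨n, hn⟩ := hm.exists
  have hnonneg : 0 ≤ a ^ 2 - dist y z ^ 2 / 4 := (sq_nonneg _).trans hn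
  have hR : asympRadius x F ≤ √(a ^ 2 - dist y z ^ 2 / 4) :=
    asympRadius_le ⟨_, hm.mono fun _ => Real.le_sqrt_of_sq_le⟩
  have := (Real.le_sqrt (asympRadius_nonneg x F) hnonneg).1 hR
  linarith

lemma exists_asympCenter [CompleteSpace H] (D : GeodesicStructure H) {x : ℕ → H}
    (hx : Bornology.IsBounded (Set.range x)) (F : Filter ℕ) [F.NeBot] :
    ∃ l, ∀ r > asympRadius x F, ∀ᶠ n in F, dist (x n) l ≤ r := by
  set R := asympRadius x F with hRdef
  have hex : ∀ r > R, ∃ y, ∀ᶠ n in F, dist (x n) y ≤ r := by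
    intro r hr
    obtain ⟨s, ⟨y, hy⟩, hs⟩ := exists_lt_of_csInf_lt (eventualRadii_nonempty hx F) hr
    exact ⟨y, hy.mono fun n hn => hn.trans hs.le⟩
  have hpos : ∀ k : ℕ, (0 : ℝ) < 1 / ((k : ℝ) + 1) := fun k => Nat.one_div_pos_of_nat
  choose y hy using fun k : ℕ => hex (R + 1 / ((k : ℝ) + 1)) (lt_add_of_pos_right _ (hpos k))
  have hlim : Tendsto (fun k : ℕ => R + 1 / ((k : ℝ) + 1)) atTop (𝓝 R) := by
    simpa using tendsto_one_div_add_atTop_nhds_zero_nat.const_add R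
  have hcauchy : CauchySeq y := by
    refine cauchySeq_of_le_tendsto_0
      (fun k : ℕ => √(4 * ((R + 1 / ((k : ℝ) + 1)) ^ 2 - R ^ 2))) ?_ ?_
    · intro i j N hi hj
      refine Real.le_sqrt_of_sq_le (dist_sq_le_of_eventually_le D ?_ ?_)
      · exact (hy i).mono fun n hn => hn.trans (by gcongr)
      · exact (hy j).mono fun n hn => hn.trans (by gcongr)
    · have h := (((hlim.pow 2).sub_const (R ^ 2)).const_mul 4).sqrt
      rwa [sub_self, mul_zero, Real.sqrt_zero] at h
  obtain ⟨l, hl⟩ := cauchySeq_tendsto_of_complete hcauchy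
  refine ⟨l, fun r hr => ?_⟩
  have hsum : Tendsto (fun k : ℕ => R + 1 / ((k : ℝ) + 1) + dist (y k) l) atTop (𝓝 R) := by
    simpa using hlim.add (tendsto_iff_dist_tendsto_zero.1 hl)
  obtain ⟨k, hk⟩ := (hsum.eventually_lt_const hr).exists
  filter_upwards [hy k] with n hn
  linarith [dist_triangle (x n) (y k) l]

/-- Below every countably generated filter there is a countably generated filter whose
asymptotic radius cannot be decreased by passing to a finer one. -/
lemma exists_regular_filter {x : ℕ → H} (hx : Bornology.IsBounded (Set.range x))
    (F₀ : Filter ℕ) [F₀.NeBot] [F₀.IsCountablyGenerated] :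
    ∃ F ≤ F₀, F.NeBot ∧ F.IsCountablyGenerated ∧ ∀ G ≤ F, G.NeBot → G.IsCountablyGenerated →
      asympRadius x F ≤ asympRadius x G := by
  let T := {F : Filter ℕ // F.NeBot ∧ F.IsCountablyGenerated}
  have hstep : ∀ (k : ℕ) (F : T), ∃ G : T, G.1 ≤ F.1 ∧
      ∀ G' : T, G'.1 ≤ F.1 → asympRadius x G.1 ≤ asympRadius x G'.1 + 1 / ((k : ℝ) + 1) := by
    intro k F
    let S : Set ℝ := (fun G : T => asympRadius x G.1) '' {G | G.1 ≤ F.1}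
    have hbdd : BddBelow S := by
      refine ⟨0, ?_⟩
      rintro _ ⟨G, -, rfl⟩
      have := G.2.1
      exact asympRadius_nonneg x G.1
    have hpos : (0 : ℝ) < 1 / ((k : ℝ) + 1) := Nat.one_div_pos_of_nat
    obtain ⟨_, ⟨G, hG, rfl⟩, hlt⟩ := exists_lt_of_csInf_lt
      (s := S) ⟨_, F, le_refl F.1, rfl⟩ (lt_add_of_pos_right _ hpos)
    refine ⟨G, hG, fun G' hG' => hlt.le.trans ?_⟩
    gcongr
    exact csInf_le hbdd ⟨G', hG', rfl⟩
  choose next hnext_le hnext using hstep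
  let A : ℕ → T := fun n => Nat.rec ⟨F₀, ‹_›, ‹_›⟩ (fun k F => next k F) n
  have hA : ∀ k, A (k + 1) = next k (A k) := fun _ => rfl
  have hanti : Antitone fun k => (A k).1 :=
    antitone_nat_of_succ_le fun k => by rw [hA]; exact hnext_le k (A k)
  have hA_neBot : ∀ k, (A k).1.NeBot := fun k => (A k).2.1
  have hA_gen : ∀ k, (A k).1.IsCountablyGenerated := fun k => (A k).2.2
  have hne : (⨅ k, (A k).1).NeBot := iInf_neBot_of_directed' hanti.directed_ge hA_neBot
  refine ⟨⨅ k, (A k).1, iInf_le (fun k => (A k).1) 0, hne, inferInstance,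
    fun G hG hGne hGgen => ?_⟩
  have hle : ∀ k : ℕ, asympRadius x (⨅ k, (A k).1) ≤ asympRadius x G + 1 / ((k : ℝ) + 1) := by
    intro k
    refine (asympRadius_mono hx (iInf_le (fun k => (A k).1) (k + 1))).trans ?_
    rw [hA]
    exact hnext k (A k) ⟨G, hGne, hGgen⟩ (hG.trans (iInf_le (fun k => (A k).1) k))
  have hlim : Tendsto (fun k : ℕ => asympRadius x G + 1 / ((k : ℝ) + 1)) atTop
      (𝓝 (asympRadius x G)) := by
    simpa using tendsto_one_div_add_atTop_nhds_zero_nat.const_add (asympRadius x G)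
  exact ge_of_tendsto' hlim hle

lemma isCompact_seg (D : GeodesicStructure H) (x y : H) : IsCompact (seg D x y) := by
  refine isCompact_Icc.image_of_continuousOn ?_
  refine (LipschitzOnWith.of_dist_le_mul (K := ⟨dist x y, dist_nonneg⟩)
    fun s hs t ht => ?_).continuousOn
  rw [D.G_dist x y s hs t ht, Real.dist_eq, mul_comm]
  rfl

lemma left_mem_seg (D : GeodesicStructure H) (x y : H) : x ∈ seg D x y :=
  ⟨0, by simp, D.G_zero x y⟩

/-- Along a filter whose asymptotic radius cannot be decreased, a sequence converges weakly to
its asymptotic center. -/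
lemma tendsto_dist_proj_of_regular (D : GeodesicStructure H) {P : H → H → H → H}
    (hP : IsProjMap D P) {x : ℕ → H} {F : Filter ℕ} [F.IsCountablyGenerated]
    (hreg : ∀ G ≤ F, G.NeBot → G.IsCountablyGenerated → asympRadius x F ≤ asympRadius x G)
    {l : H} (hl : ∀ r > asympRadius x F, ∀ᶠ n in F, dist (x n) l ≤ r) (y : H) :
    Tendsto (fun n => dist l (P l y (x n))) F (𝓝 0) := by
  rw [Metric.tendsto_nhds]
  by_contra! hcon
  obtain ⟨ε, hε, hfreq⟩ := hcon
  set S : Set ℕ := {n | ε ≤ dist l (P l y (x n))}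
  have hS : ∃ᶠ n in F, n ∈ S := hfreq.mono fun n hn => by
    simpa [S, Real.dist_eq, abs_of_nonneg dist_nonneg] using hn
  have hSne : (F ⊓ 𝓟 S).NeBot := frequently_mem_iff_neBot.1 hS
  obtain ⟨p, -, hp⟩ := (isCompact_seg D l y).exists_mapClusterPt
    (f := F ⊓ 𝓟 S) (u := fun n => P l y (x n))
    (tendsto_principal.2 (Eventually.of_forall fun n => (hP l y (x n)).1))
  set G : Filter ℕ := comap (fun n => P l y (x n)) (𝓝 p) ⊓ (F ⊓ 𝓟 S) with hG
  have hGne : G.NeBot := by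
    rw [hG, neBot_inf_comap_iff_map']
    exact hp
  have hGF : G ≤ F := inf_le_right.trans inf_le_left
  have hGS : ∀ᶠ n in G, ε ≤ dist l (P l y (x n)) :=
    (inf_le_right.trans inf_le_right : G ≤ 𝓟 S) (mem_principal_self S)
  have hGp : Tendsto (fun n => P l y (x n)) G (𝓝 p) := tendsto_comap.mono_left inf_le_left
  have hεp : ε ≤ dist l p := ge_of_tendsto (tendsto_const_nhds.dist hGp) hGS
  have hR : asympRadius x F ≤ asympRadius x G := hreg G hGF hGne inferInstance
  have hR0 : 0 ≤ asympRadius x F :=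
    have := hGne.mono hGF
    asympRadius_nonneg x F
  have hbound : ∀ r > asympRadius x F, dist l p ^ 2 ≤ 4 * (r ^ 2 - asympRadius x F ^ 2) := by
    intro r hr
    obtain ⟨s, hs, hsr⟩ := exists_between hr
    have hlG := (hl s hs).filter_mono hGF
    have hpG : ∀ᶠ n in G, dist (x n) p ≤ r := by
      filter_upwards [hlG, Metric.tendsto_nhds.1 hGp (r - s) (sub_pos.2 hsr)] with n h₁ h₂
      have h₃ := (hP l y (x n)).2 l (left_mem_seg D l y)
      linarith [dist_triangle (x n) (P l y (x n)) p]
    refine (dist_sq_le_of_eventually_le D (hlG.mono fun n hn => hn.trans hsr.le) hpG).trans ?_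
    gcongr
  have hlim : Tendsto (fun r : ℝ => 4 * (r ^ 2 - asympRadius x F ^ 2))
      (𝓝[>] asympRadius x F) (𝓝 0) := by
    have : Continuous fun r : ℝ => 4 * (r ^ 2 - asympRadius x F ^ 2) := by fun_prop
    simpa using (this.tendsto (asympRadius x F)).mono_left nhdsWithin_le_nhds
  have hzero : dist l p ^ 2 ≤ 0 :=
    ge_of_tendsto hlim (eventually_mem_nhdsWithin.mono fun r hr => hbound r hr)
  have := pow_pos (hε.trans_le hεp) 2
  linarith

lemma exists_subseq_weakConv [CompleteSpace H] (D : GeodesicStructure H) {P : H → H → H → H}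
    (hP : IsProjMap D P) {x : ℕ → H} (hx : Bornology.IsBounded (Set.range x)) :
    ∃ l, ∃ φ : ℕ → ℕ, StrictMono φ ∧ WeakConv P (x ∘ φ) l := by
  obtain ⟨F, hF, hFne, hFgen, hreg⟩ := exists_regular_filter hx atTop
  obtain ⟨l, hl⟩ := exists_asympCenter D hx F
  obtain ⟨ψ, hψ⟩ := exists_seq_tendsto F
  obtain ⟨θ, hθ, hψθ⟩ := strictMono_subseq_of_tendsto_atTop (hψ.mono_right hF)
  exact ⟨l, ψ ∘ θ, hψθ, fun y =>
    (tendsto_dist_proj_of_regular D hP hreg hl y).comp (hψ.comp hθ.tendsto_atTop)⟩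

lemma WeakConv.eventually_mem {P : H → H → H → H} {x : ℕ → H} {l : H} (h : WeakConv P x l)
    {U : Set H} (hU : WeaklyOpen P U) (hl : l ∈ U) : ∀ᶠ n in atTop, x n ∈ U := by
  obtain ⟨ε, hε, Y, -, hY⟩ := hU l hl
  have : ∀ᶠ n in atTop, ∀ y ∈ Y, dist l (P l y (x n)) < ε :=
    (Finset.eventually_all Y).2 fun y _ => (h y).eventually_lt_const hε
  exact this.mono fun n hn => hY hn

/-- in a Hadamard space whose weak topology is Hausdorff, a
bounded weakly compact set is weakly sequentially compact. -/
theorem stmt8 [CompleteSpace H] (D : GeodesicStructure H) (P : H → H → H → H)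
    (hP : IsProjMap D P)
    (hHaus : ∀ x y : H, x ≠ y → ∃ U V : Set H, WeaklyOpen P U ∧ WeaklyOpen P V ∧
      x ∈ U ∧ y ∈ V ∧ Disjoint U V)
    (K : Set H) (hb : Bornology.IsBounded K)
    (hcomp : ∀ 𝒰 : Set (Set H), (∀ U ∈ 𝒰, WeaklyOpen P U) → K ⊆ ⋃₀ 𝒰 →
      ∃ F : Finset (Set H), ↑F ⊆ 𝒰 ∧ K ⊆ ⋃₀ ↑F) :
    ∀ x : ℕ → H, (∀ n, x n ∈ K) →
      ∃ l ∈ K, ∃ φ : ℕ → ℕ, StrictMono φ ∧ WeakConv P (x ∘ φ) l := by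
  intro x hx
  obtain ⟨l, φ, hφ, hconv⟩ :=
    exists_subseq_weakConv D hP (hb.subset (Set.range_subset_iff.2 hx))
  refine ⟨l, ?_, φ, hφ, hconv⟩
  by_contra hlK
  obtain ⟨F, hF, hKF⟩ := hcomp
    {U | WeaklyOpen P U ∧ ∃ V, WeaklyOpen P V ∧ l ∈ V ∧ Disjoint U V} (fun U hU => hU.1) (by
      intro z hz
      obtain ⟨U, V, hU, hV, hzU, hlV, hUV⟩ := hHaus z l (fun h => hlK (h ▸ hz))
      exact ⟨U, ⟨hU, V, hV, hlV, hUV⟩, hzU⟩)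
  have hev : ∀ᶠ n in atTop, ∀ U ∈ F, (x ∘ φ) n ∉ U := by
    refine (Finset.eventually_all F).2 fun U hU => ?_
    obtain ⟨-, V, hV, hlV, hUV⟩ := hF hU
    exact (hconv.eventually_mem hV hlV).mono fun n hn hnU => Set.disjoint_left.1 hUV hnU hn
  obtain ⟨n, hn⟩ := hev.exists
  obtain ⟨U, hU, hxU⟩ := hKF (hx (φ n))
  exact hn U hU hxU
end

section
/- Let (H, d) be a Hadamard space and x, a, b ∈ H. If d(x, P_{[x,a]} y) = d(x, P_{[x,b]} y) for every y ∈ H, then a = b. (This is the definiteness of the distance d_* on the dual space H*_x, which is the essential content of the assertion that (H*_x, d_*) is a metric space, Lemma 4.1.) -/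
open Filter Topology

variable {H : Type*} [MetricSpace H]

theorem right_mem_seg (D : GeodesicStructure H) (x y : H) : y ∈ seg D x y :=
  ⟨1, by norm_num, D.G_one x y⟩

/-- Points of a geodesic segment lie metrically between its endpoints. -/
theorem dist_add_dist_of_mem_seg (D : GeodesicStructure H) {x y p : H} (hp : p ∈ seg D x y) :
    dist x p + dist p y = dist x y := by
  obtain ⟨t, ht, rfl⟩ := hp
  have h0 := D.G_dist x y 0 (by norm_num) t ht
  have h1 := D.G_dist x y t ht 1 (by norm_num)
  rw [D.G_zero, zero_sub, abs_neg, abs_of_nonneg ht.1] at h0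
  rw [D.G_one, abs_of_nonpos (by linarith [ht.2])] at h1
  simp only [h0, h1]
  ring

/-- If `b` is a nearest point to `a` on `[x, b]` and `a`, `b` are equidistant from `x`,
then `a = b`. -/
theorem eq_of_nearest_of_dist_eq (D : GeodesicStructure H) {x a b : H}
    (hb : ∀ q ∈ seg D x b, dist a b ≤ dist a q) (hd : dist x a = dist x b) : a = b := by
  by_contra hne
  have hpos : 0 < dist a b ^ 2 := by have := dist_pos.2 hne; positivity
  have key : ∀ s : ℝ, 0 < s → s ≤ 1 → dist a b ^ 2 ≤ s * dist x b ^ 2 := by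
    intro s hs0 hs1
    have ht : 1 - s ∈ Set.Icc (0 : ℝ) 1 := ⟨by linarith, by linarith⟩
    have hq := hb _ ⟨1 - s, ht, rfl⟩
    have hsq : dist a b ^ 2 ≤ dist (D.G x b (1 - s)) a ^ 2 := by
      rw [dist_comm _ a]
      exact pow_le_pow_left₀ dist_nonneg hq 2
    have hc := D.cat0 x b a (1 - s) ht
    rw [hd, dist_comm b a] at hc
    refine le_of_mul_le_mul_left ?_ hs0
    linarith
  have hr : 0 ≤ dist x b ^ 2 := sq_nonneg _
  have hden : 0 < dist a b ^ 2 + dist x b ^ 2 := by positivity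
  have := key (dist a b ^ 2 / (dist a b ^ 2 + dist x b ^ 2)) (by positivity)
    ((div_le_one hden).2 (by linarith))
  rw [div_mul_eq_mul_div, le_div_iff₀ hden] at this
  nlinarith

/-- A nearest-point projection onto `[x, a]` fixes the endpoint `a`. -/
theorem IsProjMap.apply_right {D : GeodesicStructure H} {P : H → H → H → H}
    (hP : IsProjMap D P) (x a : H) : P x a a = a := by
  have := (hP x a a).2 a (right_mem_seg D x a)
  rw [dist_self] at this
  exact (dist_le_zero.1 this).symm

/-- definiteness of the dual distance: if the projections of
every point `y` onto `[x,a]` and `[x,b]` are equidistant from `x`, then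
`a = b`. -/
theorem stmt12 [CompleteSpace H] (D : GeodesicStructure H) (P : H → H → H → H)
    (hP : IsProjMap D P) (x a b : H)
    (h : ∀ y : H, dist x (P x a y) = dist x (P x b y)) : a = b := by
  have ha := h a
  have hb := h b
  rw [hP.apply_right] at ha hb
  have hab := dist_add_dist_of_mem_seg D (hP x b a).1
  have hba := dist_add_dist_of_mem_seg D (hP x a b).1
  have hab0 := dist_nonneg (x := P x b a) (y := b)
  have hba0 := dist_nonneg (x := P x a b) (y := a)
  have hproj : P x b a = b := dist_le_zero.1 (by linarith)
  refine eq_of_nearest_of_dist_eq D (x := x) ?_ (by linarith)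
  simpa only [hproj] using (hP x b a).2
end
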